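/- arXiv:2410.18113 — 2 statements merged into one kernel-verified Lean document; each statement's English description precedes it below -/
import Mathlib

section
/- Let M, K, φ, T_m be natural numbers with K ≤ M, 1 ≤ φ ≤ M, 1 ≤ T_m ≤ φ, and let N, K', ψ, T_n be natural numbers with K' ≤ N, 1 ≤ ψ ≤ N, 1 ≤ T_n ≤ ψ. Define the real numbers s = K/M − (T_m−1)/φ and t = K'/N − (T_n−1)/ψ, and assume s ≥ 0 and t ≥ 0. Then (∑_{α=0}^{T_m−1} C(K,α)·C(M−K, φ−α)/C(M,φ)) · (∑_{β=0}^{T_n−1} C(K',β)·C(N−K', ψ−β)/C(N,ψ)) ≤ exp(−2·(s²·φ + t²·ψ)). -/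
/-- Hoeffding's lemma for a Bernoulli variable of parameter `q`. -/
theorem one_sub_add_mul_exp_le (q x : ℝ) (hq0 : 0 ≤ q) (hq1 : q ≤ 1) :
    1 - q + q * Real.exp x ≤ Real.exp (q * x + x ^ 2 / 8) := by
  let p : unitInterval := ⟨q, hq0, hq1⟩
  let μ := ProbabilityTheory.bernoulliMeasure (1 : ℝ) 0 p
  have hmean : ∫ ω, ω ∂μ = q := by
    simp [μ, p, ProbabilityTheory.integral_bernoulliMeasure]
  have hmem : ∀ᵐ ω ∂μ, (id ω : ℝ) ∈ Set.Icc (0 : ℝ) 1 := by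
    have hzero : μ (Set.Icc (0 : ℝ) 1)ᶜ = 0 := by
      rw [ProbabilityTheory.bernoulliMeasure_apply_of_notMem_of_notMem] <;> simp
    exact hzero
  have hmgf := (ProbabilityTheory.hasSubgaussianMGF_of_mem_Icc aemeasurable_id hmem).mgf_le x
  simp only [id_eq, hmean, ProbabilityTheory.mgf, μ,
    ProbabilityTheory.integral_bernoulliMeasure] at hmgf
  have hexp : q * Real.exp (x * (1 - q)) + (1 - q) * Real.exp (x * (0 - q))
      ≤ Real.exp (x ^ 2 / 8) := by
    have hparam : (((‖(1 : ℝ) - 0‖₊ / 2) ^ 2 : NNReal) : ℝ) * x ^ 2 / 2 = x ^ 2 / 8 := by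
      norm_num
      ring
    rwa [hparam] at hmgf
  calc 1 - q + q * Real.exp x
      = Real.exp (q * x) *
          (q * Real.exp (x * (1 - q)) + (1 - q) * Real.exp (x * (0 - q))) := by
        have h₁ : Real.exp (q * x) * Real.exp (x * (1 - q)) = Real.exp x := by
          rw [← Real.exp_add]; ring_nf
        have h₀ : Real.exp (q * x) * Real.exp (x * (0 - q)) = 1 := by
          rw [← Real.exp_add]; ring_nf; exact Real.exp_zero
        linear_combination -q * h₁ - (1 - q) * h₀
    _ ≤ Real.exp (q * x) * Real.exp (x ^ 2 / 8) := by gcongr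
    _ = Real.exp (q * x + x ^ 2 / 8) := (Real.exp_add _ _).symm

theorem descFactorial_mul_pow_le {L M : ℕ} (hLM : L ≤ M) (j : ℕ) :
    L.descFactorial j * M ^ j ≤ M.descFactorial j * L ^ j := by
  induction j with
  | zero => simp
  | succ j ih =>
    have hstep : (L - j) * M ≤ (M - j) * L := by
      rw [Nat.sub_mul, Nat.sub_mul, mul_comm M L]
      gcongr
    calc L.descFactorial (j + 1) * M ^ (j + 1)
        = ((L - j) * M) * (L.descFactorial j * M ^ j) := by
          rw [Nat.descFactorial_succ]; ring
      _ ≤ ((M - j) * L) * (M.descFactorial j * L ^ j) := Nat.mul_le_mul hstep ih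
      _ = M.descFactorial (j + 1) * L ^ (j + 1) := by
          rw [Nat.descFactorial_succ]; ring

theorem choose_mul_pow_le {L M : ℕ} (hLM : L ≤ M) (j : ℕ) :
    L.choose j * M ^ j ≤ M.choose j * L ^ j := by
  refine Nat.le_of_mul_le_mul_left ?_ j.factorial_pos
  rw [← mul_assoc, ← mul_assoc, ← Nat.descFactorial_eq_factorial_mul_choose,
    ← Nat.descFactorial_eq_factorial_mul_choose]
  exact descFactorial_mul_pow_le hLM j

theorem sum_choose_mul_choose_mul_one_add_pow (K L n : ℕ) (w : ℝ) :
    ∑ α ∈ Finset.range (n + 1), (K.choose α : ℝ) * L.choose (n - α) * (1 + w) ^ (n - α)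
      = ∑ j ∈ Finset.range (n + 1), (L.choose j : ℝ) * (K + L - j).choose (n - j) * w ^ j := by
  open Polynomial in
  have hcoeff (b : ℕ) : ((1 + C (1 + w) * X : ℝ[X]) ^ L).coeff b
      = L.choose b * (1 + w) ^ b := by
    have hcomp : (1 + C (1 + w) * X : ℝ[X]) ^ L = ((1 + X) ^ L).comp (C (1 + w) * X) := by simp
    rw [hcomp, comp_C_mul_X_coeff, coeff_one_add_X_pow]
  open Polynomial in
  have hexpand : ((1 + X) ^ K * (1 + C (1 + w) * X) ^ L : ℝ[X])
      = ∑ j ∈ Finset.range (L + 1),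
          C ((L.choose j : ℝ) * w ^ j) * (X ^ j * (1 + X) ^ (K + L - j)) := by
    have hsplit : (1 + C (1 + w) * X : ℝ[X]) = C w * X + (1 + X) := by
      rw [C_add, C_1]; ring
    rw [hsplit, add_pow (C w * X), Finset.mul_sum]
    refine Finset.sum_congr rfl fun j hj => ?_
    rw [Nat.add_sub_assoc (Finset.mem_range_succ_iff.1 hj), pow_add, C_mul, C_pow, mul_pow]
    simp only [map_natCast]
    ring
  have hn := congrArg (fun p => Polynomial.coeff p n) hexpand
  simp only [Polynomial.coeff_mul ((1 + Polynomial.X) ^ K), hcoeff, Polynomial.coeff_one_add_X_pow,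
    Polynomial.finsetSum_coeff, Polynomial.coeff_C_mul, Polynomial.coeff_X_pow_mul',
    Finset.Nat.sum_antidiagonal_eq_sum_range_succ_mk] at hn
  simp only [mul_assoc] at hn ⊢
  rw [hn]
  have hL : ∀ j ∈ Finset.range (L + n + 1), j ∉ Finset.range (L + 1) →
      (L.choose j : ℝ) * (w ^ j * if j ≤ n then ((K + L - j).choose (n - j) : ℝ) else 0) = 0 := by
    intro j _ hj
    rw [Nat.choose_eq_zero_of_lt (by simpa using hj)]; simp
  have hN : ∀ j ∈ Finset.range (L + n + 1), j ∉ Finset.range (n + 1) →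
      (L.choose j : ℝ) * (w ^ j * if j ≤ n then ((K + L - j).choose (n - j) : ℝ) else 0) = 0 := by
    intro j _ hj
    rw [if_neg (by simpa using hj)]; simp
  rw [Finset.sum_subset (Finset.range_subset_range.2 (by omega)) hL,
    ← Finset.sum_subset (Finset.range_subset_range.2 (by omega)) hN]
  refine Finset.sum_congr rfl fun j hj => ?_
  rw [if_pos (Finset.mem_range_succ_iff.1 hj), mul_comm (w ^ j)]

/-- The generating function of the hypergeometric distribution is dominated, for arguments at
least `1`, by the one of the binomial distribution with the same mean. -/
theorem sum_choose_mul_choose_mul_pow_le (K L n : ℕ) (hM : 0 < K + L) {u : ℝ} (hu : 1 ≤ u) :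
    ∑ α ∈ Finset.range (n + 1), (K.choose α : ℝ) * L.choose (n - α) * u ^ (n - α)
      ≤ (K + L).choose n * (1 - (L : ℝ) / (K + L) + L / (K + L) * u) ^ n := by
  obtain ⟨w, rfl⟩ : ∃ w, u = 1 + w := ⟨u - 1, by ring⟩
  have hw : 0 ≤ w := by linarith
  have hM' : (0 : ℝ) < K + L := by exact_mod_cast hM
  have hbase : 1 - (L : ℝ) / (K + L) + L / (K + L) * (1 + w) = L / (K + L) * w + 1 := by ring
  rw [sum_choose_mul_choose_mul_one_add_pow, hbase, add_pow, Finset.mul_sum]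
  refine Finset.sum_le_sum fun j hj => ?_
  have hchoose : (L.choose j : ℝ) ≤ (K + L).choose j * ((L : ℝ) / (K + L)) ^ j := by
    rw [div_pow, mul_div_assoc', le_div_iff₀ (by positivity)]
    exact_mod_cast choose_mul_pow_le (Nat.le_add_left L K) j
  have hmul : ((K + L).choose n : ℝ) * n.choose j
      = (K + L).choose j * (K + L - j).choose (n - j) := by
    exact_mod_cast Nat.choose_mul (n := K + L) (Finset.mem_range_succ_iff.1 hj)
  calc (L.choose j : ℝ) * (K + L - j).choose (n - j) * w ^ j
      ≤ (K + L).choose j * ((L : ℝ) / (K + L)) ^ j * (K + L - j).choose (n - j) * w ^ j := by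
        gcongr
    _ = _ := by
        rw [mul_pow, one_pow]
        linear_combination (-((L : ℝ) / (K + L)) ^ j * w ^ j) * hmul

theorem hypergeometric_lower_tail_le (M K n T : ℕ) (hKM : K ≤ M) (hn : 1 ≤ n) (hnM : n ≤ M)
    (hT : 1 ≤ T) (hTn : T ≤ n) (s : ℝ) (hs : s = (K : ℝ) / M - ((T : ℝ) - 1) / n) (hs0 : 0 ≤ s) :
    ∑ α ∈ Finset.range T, ((K.choose α : ℝ) * ((M - K).choose (n - α) : ℝ)) / (M.choose n : ℝ)
      ≤ Real.exp (-2 * (s ^ 2 * n)) := by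
  obtain ⟨L, rfl⟩ := Nat.exists_eq_add_of_le hKM
  rw [Nat.add_sub_cancel_left, ← Finset.sum_div, div_le_iff₀ (by exact_mod_cast Nat.choose_pos hnM)]
  have hM : 0 < K + L := by omega
  have hM' : (0 : ℝ) < K + L := by exact_mod_cast hM
  have hn' : (0 : ℝ) < n := by exact_mod_cast hn
  have hu : 1 ≤ Real.exp (4 * s) := Real.one_le_exp (by linarith)
  have hq1 : (L : ℝ) / (K + L) ≤ 1 := by
    rw [div_le_one hM']; linarith [(K.cast_nonneg : (0 : ℝ) ≤ K)]
  have hmarkov : (∑ α ∈ Finset.range T, (K.choose α : ℝ) * L.choose (n - α))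
        * Real.exp (4 * s) ^ (n - T + 1)
      ≤ ∑ α ∈ Finset.range (n + 1),
          (K.choose α : ℝ) * L.choose (n - α) * Real.exp (4 * s) ^ (n - α) := by
    rw [Finset.sum_mul]
    refine (Finset.sum_le_sum fun α hα => ?_).trans
      (Finset.sum_le_sum_of_subset_of_nonneg (Finset.range_subset_range.2 (by omega))
        fun _ _ _ => by positivity)
    have hαT := Finset.mem_range.1 hα
    exact mul_le_mul_of_nonneg_left (pow_le_pow_right₀ hu (by omega)) (by positivity)
  have hbernoulli := one_sub_add_mul_exp_le ((L : ℝ) / (K + L)) (4 * s) (by positivity) hq1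
  have hbase : 0 ≤ 1 - (L : ℝ) / (K + L) + L / (K + L) * Real.exp (4 * s) :=
    add_nonneg (by linarith) (by positivity)
  have hexponent : n * ((L : ℝ) / (K + L) * (4 * s) + (4 * s) ^ 2 / 8)
      = -2 * (s ^ 2 * n) + ((n - T + 1 : ℕ) : ℝ) * (4 * s) := by
    have hsn : s * n = n - n * ((L : ℝ) / (K + L)) - (T - 1) := by
      rw [hs]; push_cast; field_simp; ring
    push_cast [Nat.cast_sub hTn]
    linear_combination 4 * s * hsn
  refine le_of_mul_le_mul_right ?_ (pow_pos (Real.exp_pos (4 * s)) (n - T + 1))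
  calc _ ≤ _ := hmarkov
    _ ≤ _ := sum_choose_mul_choose_mul_pow_le K L n hM hu
    _ ≤ (K + L).choose n * Real.exp ((L : ℝ) / (K + L) * (4 * s) + (4 * s) ^ 2 / 8) ^ n := by
        gcongr
    _ = _ := by
        rw [← Real.exp_nat_mul, hexponent, Real.exp_add, Real.exp_nat_mul]
        ring


theorem joint_hypergeometric_lower_tail_bound
    (M K φ Tm : ℕ) (hKM : K ≤ M) (hφ1 : 1 ≤ φ) (hφM : φ ≤ M)
    (hTm1 : 1 ≤ Tm) (hTmφ : Tm ≤ φ)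
    (N K' ψ Tn : ℕ) (hK'N : K' ≤ N) (hψ1 : 1 ≤ ψ) (hψN : ψ ≤ N)
    (hTn1 : 1 ≤ Tn) (hTnψ : Tn ≤ ψ)
    (s t : ℝ)
    (hs : s = (K : ℝ) / M - ((Tm : ℝ) - 1) / φ)
    (ht : t = (K' : ℝ) / N - ((Tn : ℝ) - 1) / ψ)
    (hs0 : 0 ≤ s) (ht0 : 0 ≤ t) :
    (∑ α ∈ Finset.range Tm,
        ((K.choose α : ℝ) * ((M - K).choose (φ - α) : ℝ)) / (M.choose φ : ℝ)) *
    (∑ β ∈ Finset.range Tn,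
        ((K'.choose β : ℝ) * ((N - K').choose (ψ - β) : ℝ)) / (N.choose ψ : ℝ))
      ≤ Real.exp (-2 * (s ^ 2 * φ + t ^ 2 * ψ)) := by
  rw [mul_add, Real.exp_add]
  exact mul_le_mul
    (hypergeometric_lower_tail_le M K φ Tm hKM hφ1 hφM hTm1 hTmφ s hs hs0)
    (hypergeometric_lower_tail_le N K' ψ Tn hK'N hψ1 hψN hTn1 hTnψ t ht ht0)
    (Finset.sum_nonneg fun _ _ => by positivity) (Real.exp_pos _).le
end

section
/- Let A be a real M × N matrix with all row sums and all column sums strictly positive. Let D₁ be the M × M diagonal matrix whose i-th diagonal entry is the i-th row sum of A, and D₂ the N × N diagonal matrix whose j-th diagonal entry is the j-th column sum of A. Let W be the (M+N) × (M+N) block matrix [[0, A], [Aᵀ, 0]], D the (M+N) × (M+N) block-diagonal matrix diag(D₁, D₂), and L = D − W the Laplacian. Let A_n = D₁^{−1/2} · A · D₂^{−1/2} be the normalized matrix, and suppose u ∈ ℝ^M and v ∈ ℝ^N form a singular pair of A_n with singular value σ, i.e., A_n · v = σ·u and A_nᵀ · u = σ·v. Then the vector z = (D₁^{−1/2}·u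 ; D₂^{−1/2}·v) ∈ ℝ^{M+N} satisfies the generalized eigenvalue equation L·z = (1 − σ)·D·z. -/
open Matrix

/-- If `D^{-1/2} w = σ u` for a positive diagonal matrix `D`, then `w = σ D (D^{-1/2} u)`. -/
theorem eq_smul_diagonal_mulVec_of_invSqrt_mulVec_eq {ι : Type*} [Fintype ι] [DecidableEq ι]
    {d : ι → ℝ} (hd : ∀ i, 0 < d i) {w u : ι → ℝ} {σ : ℝ}
    (h : (Matrix.diagonal fun i => (Real.sqrt (d i))⁻¹).mulVec w = σ • u) :
    w = σ • (Matrix.diagonal d).mulVec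
      ((Matrix.diagonal fun i => (Real.sqrt (d i))⁻¹).mulVec u) := by
  ext i
  have hi := congrFun h i
  have hpos := Real.sqrt_pos.2 (hd i)
  have hsq := Real.mul_self_sqrt (hd i).le
  simp only [Matrix.mulVec_diagonal, Pi.smul_apply, smul_eq_mul] at hi ⊢
  rw [inv_mul_eq_iff_eq_mul₀ hpos.ne'] at hi
  rw [hi]
  nth_rewrite 2 [← hsq]
  field_simp

theorem spectral_cocluster_generalized_eigenvector
    (M N : ℕ) (A : Matrix (Fin M) (Fin N) ℝ)
    (hrow : ∀ i : Fin M, 0 < ∑ j, A i j)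
    (hcol : ∀ j : Fin N, 0 < ∑ i, A i j)
    (D₁ : Matrix (Fin M) (Fin M) ℝ) (hD₁ : D₁ = Matrix.diagonal (fun i => ∑ j, A i j))
    (D₂ : Matrix (Fin N) (Fin N) ℝ) (hD₂ : D₂ = Matrix.diagonal (fun j => ∑ i, A i j))
    (D₁invSqrt : Matrix (Fin M) (Fin M) ℝ)
    (hD₁inv : D₁invSqrt = Matrix.diagonal (fun i => (Real.sqrt (∑ j, A i j))⁻¹))
    (D₂invSqrt : Matrix (Fin N) (Fin N) ℝ)
    (hD₂inv : D₂invSqrt = Matrix.diagonal (fun j => (Real.sqrt (∑ i, A i j))⁻¹))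
    (W : Matrix (Fin M ⊕ Fin N) (Fin M ⊕ Fin N) ℝ)
    (hW : W = Matrix.fromBlocks 0 A Aᵀ 0)
    (D : Matrix (Fin M ⊕ Fin N) (Fin M ⊕ Fin N) ℝ)
    (hD : D = Matrix.fromBlocks D₁ 0 0 D₂)
    (L : Matrix (Fin M ⊕ Fin N) (Fin M ⊕ Fin N) ℝ) (hL : L = D - W)
    (An : Matrix (Fin M) (Fin N) ℝ) (hAn : An = D₁invSqrt * A * D₂invSqrt)
    (u : Fin M → ℝ) (v : Fin N → ℝ) (σ : ℝ)
    (hu : An.mulVec v = σ • u) (hv : Anᵀ.mulVec u = σ • v)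
    (z : Fin M ⊕ Fin N → ℝ)
    (hz : z = Sum.elim (D₁invSqrt.mulVec u) (D₂invSqrt.mulVec v)) :
    L.mulVec z = (1 - σ) • D.mulVec z := by
  subst hAn hL hD hW hz
  have hAv : A.mulVec (D₂invSqrt.mulVec v) = σ • D₁.mulVec (D₁invSqrt.mulVec u) := by
    subst hD₁ hD₁inv
    apply eq_smul_diagonal_mulVec_of_invSqrt_mulVec_eq hrow
    simpa only [Matrix.mulVec_mulVec, Matrix.mul_assoc] using hu
  have hAu : Aᵀ.mulVec (D₁invSqrt.mulVec u) = σ • D₂.mulVec (D₂invSqrt.mulVec v) := by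
    subst hD₂ hD₂inv hD₁inv
    apply eq_smul_diagonal_mulVec_of_invSqrt_mulVec_eq hcol
    simpa only [Matrix.mulVec_mulVec, Matrix.transpose_mul, Matrix.diagonal_transpose] using hv
  rw [Matrix.sub_mulVec, sub_smul, one_smul]
  congr 1
  simp only [Matrix.fromBlocks_mulVec, Sum.elim_comp_inl, Sum.elim_comp_inr, Matrix.zero_mulVec,
    zero_add, add_zero, hAv, hAu]
  ext (i | j) <;> rfl
end
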